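/- arXiv:2007.05654 — 5 statements merged into one kernel-verified Lean document; each statement's English description precedes it below -/
import Mathlib

section
/- Let n ≥ 1, x₀ ∈ ℝⁿ, r > 0, and let ũ : ℝⁿ → ℝ be defined by ũ(y) = (ωₙ/(2n(n+2)))·(r^{n+2} − ‖y − x₀‖^{n+2}). Then ũ vanishes on the sphere ∂B_r(x₀) and for every x ∈ B_r(x₀) one has Δũ(x) = −|{y ∈ B_r(x₀) : ũ(y) ≥ ũ(x)}|, where |·| is the n-dimensional Lebesgue measure. That is, ũ is an explicit classical solution of the equation Δu(x) = −|{u ≥ u(x)}| in B_r(x₀) with zero Dirichlet boundary values. -/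
open MeasureTheory Metric

section NormPow

variable {E : Type*} [NormedAddCommGroup E] [InnerProductSpace ℝ E]

lemma hasFDerivAt_norm_pow_of_ne_zero {x : E} (hx : x ≠ 0) (n : ℕ) :
    HasFDerivAt (fun z : E => ‖z‖ ^ n) ((n * ‖x‖ ^ ((n : ℝ) - 2)) • innerSL ℝ x) x := by
  convert! ((hasStrictFDerivAt_norm_sq x).rpow_const (p := (n : ℝ) / 2)
    (by simp [hx])).hasFDerivAt using 1
  · ext z
    rw [← Real.rpow_natCast_mul (norm_nonneg _), ← Real.rpow_natCast]
    congr 1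
    push_cast
    ring
  · rw [← Real.rpow_natCast_mul (norm_nonneg _), ← Nat.cast_smul_eq_nsmul ℝ, smul_smul]
    congr 1
    push_cast
    ring_nf

lemma hasFDerivAt_norm_pow_add_two (x : E) (n : ℕ) :
    HasFDerivAt (fun z : E => ‖z‖ ^ (n + 2)) (((n + 2) * ‖x‖ ^ n) • innerSL ℝ x) x := by
  have h := hasFDerivAt_norm_rpow x (p := (n : ℝ) + 2) (by linarith [n.cast_nonneg (α := ℝ)])
  rw [add_sub_cancel_right, Real.rpow_natCast] at h
  convert! h using 2 with z
  exact_mod_cast (Real.rpow_natCast ‖z‖ (n + 2)).symm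

lemma hasFDerivAt_norm_pow_mul_inner {n : ℕ} (hn : n ≠ 0) (x e : E) :
    HasFDerivAt (fun z : E => ‖z‖ ^ n * inner ℝ z e)
      ((n * ‖x‖ ^ ((n : ℝ) - 2) * inner ℝ x e) • innerSL ℝ x + ‖x‖ ^ n • innerSL ℝ e) x := by
  rcases eq_or_ne x 0 with rfl | hx
  · simp only [map_zero, smul_zero, norm_zero, zero_pow hn, zero_smul, add_zero]
    refine Asymptotics.IsBigO.hasFDerivAt (n := n + 1) ?_ (by lia)
    refine Asymptotics.IsBigO.of_bound ‖e‖ (Filter.Eventually.of_forall fun z => ?_)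
    simp only [sub_zero, norm_mul, norm_pow, norm_norm]
    calc ‖z‖ ^ n * ‖inner ℝ z e‖ ≤ ‖z‖ ^ n * (‖z‖ * ‖e‖) := by
          gcongr
          exact norm_inner_le_norm z e
      _ = ‖e‖ * ‖z‖ ^ (n + 1) := by ring
  · have he : HasFDerivAt (fun z : E => inner ℝ z e) (innerSL ℝ e) x := by
      convert! (innerSL ℝ e).hasFDerivAt (x := x) using 2 with z
      simp [real_inner_comm]
    convert! (hasFDerivAt_norm_pow_of_ne_zero hx n).mul he using 1
    ext v
    simp
    ring

lemma fderiv_fderiv_radial_apply {n : ℕ} (hn : n ≠ 0) (c a : ℝ) (x₀ x e : E) :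
    fderiv ℝ (fun z => fderiv ℝ (fun y => c * (a - ‖y - x₀‖ ^ (n + 2))) z e) x e =
      -(c * (n + 2)) * (n * ‖x - x₀‖ ^ ((n : ℝ) - 2) * inner ℝ (x - x₀) e ^ 2 +
        ‖x - x₀‖ ^ n * ‖e‖ ^ 2) := by
  have h₁ (z : E) : fderiv ℝ (fun y => c * (a - ‖y - x₀‖ ^ (n + 2))) z e =
      -(c * (n + 2)) * (‖z - x₀‖ ^ n * inner ℝ (z - x₀) e) := by
    have h := (((hasFDerivAt_norm_pow_add_two (z - x₀) n).comp z
      ((hasFDerivAt_id z).sub_const x₀)).const_sub a).const_mul c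
    have h' := h.fderiv
    simp only [Function.comp_def, id] at h'
    rw [h']
    simp [-map_sub]
    ring
  simp only [h₁]
  have h := (((hasFDerivAt_norm_pow_mul_inner hn (x - x₀) e).comp x
      ((hasFDerivAt_id x).sub_const x₀))).const_mul (-(c * (n + 2)))
  have h' := h.fderiv
  simp only [Function.comp_def, id] at h'
  rw [h']
  simp [-map_sub]
  ring

end NormPow

/-- `ũ(y) = (ωₙ/(2n(n+2)))·(r^(n+2) − ‖y − x₀‖^(n+2))` vanishes on the sphere
`∂B_r(x₀)` and solves `Δũ(x) = −|{y ∈ B_r(x₀) : ũ(y) ≥ ũ(x)}|` classically in `B_r(x₀)`,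
where the Laplacian is the sum of second partial derivatives along the standard basis. -/
theorem radial_solution_of_measure_equation (n : ℕ) (hn : 1 ≤ n)
    (x₀ : EuclideanSpace ℝ (Fin n)) (r : ℝ) (hr : 0 < r)
    (ω : ℝ) (hω : ω = (volume (ball (0 : EuclideanSpace ℝ (Fin n)) 1)).toReal)
    (u : EuclideanSpace ℝ (Fin n) → ℝ)
    (hu : ∀ y, u y = ω / (2 * n * (n + 2)) * (r ^ (n + 2) - ‖y - x₀‖ ^ (n + 2))) :
    (∀ y ∈ sphere x₀ r, u y = 0) ∧
      ∀ x ∈ ball x₀ r,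
        ∑ i : Fin n,
            fderiv ℝ (fun z => fderiv ℝ u z (EuclideanSpace.single i 1)) x
              (EuclideanSpace.single i 1)
          = -(volume {y ∈ ball x₀ r | u x ≤ u y}).toReal := by
  have hn' : n ≠ 0 := by lia
  have hn₀ : (n : ℝ) ≠ 0 := Nat.cast_ne_zero.2 hn'
  have hω₀ : 0 < ω := by
    rw [hω]
    exact ENNReal.toReal_pos (measure_ball_pos volume _ one_pos).ne' measure_ball_lt_top.ne
  refine ⟨fun y hy => by rw [hu, ← dist_eq_norm, mem_sphere.1 hy, sub_self, mul_zero],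
    fun x hx => ?_⟩
  have hset : {y ∈ ball x₀ r | u x ≤ u y} = closedBall x₀ ‖x - x₀‖ := by
    ext y
    have hc : 0 < ω / (2 * n * (n + 2)) := by positivity
    rw [Set.mem_ofPred_eq, hu, hu, mul_le_mul_iff_right₀ hc, sub_le_sub_iff_left,
      pow_le_pow_iff_left₀ (norm_nonneg _) (norm_nonneg _) (by lia), mem_closedBall,
      dist_eq_norm, mem_ball, dist_eq_norm, and_iff_right_iff_imp]
    rw [mem_ball, dist_eq_norm] at hx
    exact fun h => h.trans_lt hx
  have hvol : (volume (closedBall x₀ ‖x - x₀‖)).toReal = ‖x - x₀‖ ^ n * ω := by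
    rw [hω]
    simpa using! Measure.addHaar_real_closedBall volume x₀ (norm_nonneg (x - x₀))
  have hpow : ‖x - x₀‖ ^ ((n : ℝ) - 2) * ‖x - x₀‖ ^ 2 = ‖x - x₀‖ ^ n := by
    rw [← Real.rpow_natCast, ← Real.rpow_natCast, ← Real.rpow_add' (norm_nonneg _) (by simpa)]
    simp
  have hsum : ∑ i, inner ℝ (x - x₀) (EuclideanSpace.single i (1 : ℝ)) ^ 2 = ‖x - x₀‖ ^ 2 := by
    rw [EuclideanSpace.real_norm_sq_eq]
    simp [EuclideanSpace.inner_single_right]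
  rw [hset, hvol, funext hu]
  simp only [fderiv_fderiv_radial_apply hn']
  rw [← Finset.mul_sum, Finset.sum_add_distrib, ← Finset.mul_sum, hsum, mul_assoc (n : ℝ) (_ ^ _), hpow]
  simp
  field_simp
  ring
end

section
/- Let v : ℝⁿ → ℝ be a Lipschitz function and let α ∈ ℝ. Then for Lebesgue-almost every y in the level set v⁻¹(α) = {y ∈ ℝⁿ : v(y) = α}, the function v is differentiable at y and its derivative (gradient) at y is zero. Equivalently, the set {y : v(y) = α and (v is not differentiable at y or ∇v(y) ≠ 0)} has Lebesgue measure zero. -/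
open MeasureTheory

/-- At almost every point of a level set where a continuous real function on a finite-dimensional
space is differentiable, its derivative vanishes. -/
theorem measure_level_set_differentiableAt_fderiv_ne_zero {E : Type*} [NormedAddCommGroup E]
    [NormedSpace ℝ E] [FiniteDimensional ℝ E] [MeasurableSpace E] [BorelSpace E]
    (μ : Measure E) [μ.IsAddHaarMeasure] {v : E → ℝ} (hv : Continuous v) (α : ℝ) :
    μ {y | v y = α ∧ DifferentiableAt ℝ v y ∧ fderiv ℝ v y ≠ 0} = 0 := by
  rcases subsingleton_or_nontrivial E with hE | hE
  · have h (L : E →L[ℝ] ℝ) : L = 0 := by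
      ext x
      rw [Subsingleton.elim x 0, map_zero, map_zero]
    simp [h]
  obtain ⟨e, he⟩ := exists_ne (0 : E)
  set s : Set E := v ⁻¹' {α} ∩ {y | DifferentiableAt ℝ v y}
  have hs : MeasurableSet s :=
    (hv.measurable (measurableSet_singleton α)).inter (measurableSet_of_differentiableAt ℝ v)
  have happrox : ApproximatesLinearOn (fun x ↦ v x • e) (0 : E →L[ℝ] E) s 0 := by
    intro x hx y hy
    have hxy : v x = v y := hx.1.trans hy.1.symm
    simp [hxy]
  have hae := happrox.norm_fderiv_sub_le μ hs (fun x ↦ (fderiv ℝ v x).smulRight e)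
    fun x hx ↦ (hx.2.hasFDerivAt.smul_const e).hasFDerivWithinAt
  rw [ae_restrict_iff' hs] at hae
  refine measure_mono_null ?_ hae
  rintro y ⟨hy, hdiff, hne⟩ himp
  exact hne (by simpa [he] using himp ⟨hy, hdiff⟩)

/-- If `v : ℝⁿ → ℝ` is Lipschitz and `α ∈ ℝ`, then for Lebesgue-almost every `y`
in the level set `{v = α}`, `v` is differentiable at `y` with zero derivative; i.e. the set of
`y` with `v(y) = α` at which `v` fails to be differentiable with zero derivative is null. -/
theorem ae_gradient_zero_on_level_set (n : ℕ) (v : EuclideanSpace ℝ (Fin n) → ℝ)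
    (K : NNReal) (hv : LipschitzWith K v) (α : ℝ) :
    volume {y : EuclideanSpace ℝ (Fin n) |
      v y = α ∧ ¬(DifferentiableAt ℝ v y ∧ fderiv ℝ v y = 0)} = 0 := by
  have hdiff : volume {y | ¬DifferentiableAt ℝ v y} = 0 := hv.ae_differentiableAt
  refine measure_mono_null ?_ (measure_union_null hdiff
    (measure_level_set_differentiableAt_fderiv_ne_zero volume hv.continuous α))
  rintro y ⟨hy, hne⟩
  by_cases h : DifferentiableAt ℝ v y
  · exact Or.inr ⟨hy, h, fun h0 ↦ hne ⟨h, h0⟩⟩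
  · exact Or.inl h
end

section
/- Let g : ℝⁿ → ℝᵐ be a Lipschitz map and let c ∈ ℝᵐ. Then for Lebesgue-almost every y in the level set {y ∈ ℝⁿ : g(y) = c}, the map g is differentiable at y and its (total) derivative at y is the zero linear map. -/
open MeasureTheory

/-- A map between finite-dimensional real normed spaces that is constant on a measurable set `s`
has zero derivative within `s` at almost every point of `s`. -/
theorem ae_fderivWithin_eq_zero_of_eqOn_const
    {E F : Type*} [NormedAddCommGroup E] [NormedSpace ℝ E] [FiniteDimensional ℝ E]
    [MeasurableSpace E] [BorelSpace E]
    [NormedAddCommGroup F] [NormedSpace ℝ F] [FiniteDimensional ℝ F]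
    (μ : Measure E) [μ.IsAddHaarMeasure] {s : Set E} (hs : MeasurableSet s)
    {f : E → F} {f' : E → E →L[ℝ] F} {c : F} (hf : ∀ x ∈ s, f x = c)
    (hf' : ∀ x ∈ s, HasFDerivWithinAt f (f' x) s x) :
    ∀ᵐ x ∂μ.restrict s, f' x = 0 := by
  cases subsingleton_or_nontrivial E with
  | inl _ => exact .of_forall fun x => Subsingleton.elim _ _
  | inr _ =>
    obtain ⟨w, hw⟩ := exists_ne (0 : E)
    let b := Module.finBasis ℝ F
    -- Postcomposing with `z ↦ b.coord i z • w` reduces to maps from `E` to itself.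
    let B (i) : F →L[ℝ] E := (b.coord i).toContinuousLinearMap.smulRight w
    have h_comp (i) : ∀ᵐ x ∂μ.restrict s, ‖(B i).comp (f' x) - 0‖₊ ≤ 0 := by
      refine ApproximatesLinearOn.norm_fderiv_sub_le μ (f := fun x => B i (f x)) ?_ hs _
        fun x hx => (B i).hasFDerivAt.comp_hasFDerivWithinAt x (hf' x hx)
      intro x hx y hy
      simp [hf x hx, hf y hy]
    filter_upwards [ae_all_iff.2 h_comp] with x hx
    ext v
    refine b.ext_elem fun i => ?_
    have h_zero : (B i).comp (f' x) = 0 := by simpa using hx i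
    simpa [B, hw] using DFunLike.congr_fun h_zero v

/-- If `g : ℝⁿ → ℝᵐ` is Lipschitz and `c ∈ ℝᵐ`, then for Lebesgue-almost every
`y` in the level set `{g = c}`, `g` is differentiable at `y` and its total derivative at `y`
is the zero linear map. -/
theorem ae_derivative_zero_on_level_set (n m : ℕ)
    (g : EuclideanSpace ℝ (Fin n) → EuclideanSpace ℝ (Fin m))
    (K : NNReal) (hg : LipschitzWith K g) (c : EuclideanSpace ℝ (Fin m)) :
    volume {y : EuclideanSpace ℝ (Fin n) |
      g y = c ∧ ¬(DifferentiableAt ℝ g y ∧ fderiv ℝ g y = 0)} = 0 := by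
  have hs : MeasurableSet {y | g y = c ∧ DifferentiableAt ℝ g y} :=
    (hg.continuous.measurable (measurableSet_singleton c)).inter
      (measurableSet_of_differentiableAt ℝ g)
  have h_zero := (ae_restrict_iff' hs).1 <|
    ae_fderivWithin_eq_zero_of_eqOn_const volume hs (f' := fderiv ℝ g) (fun _ hx => hx.1)
      fun _ hx => hx.2.hasFDerivAt.hasFDerivWithinAt
  have h_ae : ∀ᵐ y, ¬(g y = c ∧ ¬(DifferentiableAt ℝ g y ∧ fderiv ℝ g y = 0)) := by
    filter_upwards [h_zero, hg.ae_differentiableAt] with y hy hd ⟨hc, hn⟩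
    exact hn ⟨hd, hy ⟨hc, hd⟩⟩
  simpa only [ae_iff, not_not] using h_ae
end

section
/- Let v : ℝⁿ → ℝ be a Lipschitz function. Then for Lebesgue-almost every t ∈ ℝ, the (n−1)-dimensional Hausdorff measure of the set {y ∈ ℝⁿ : v(y) = t, v is differentiable at y, and ∇v(y) = 0} is zero. -/
open MeasureTheory

section CriticalLevelSets

open Set Filter Topology Metric Module
open scoped ENNReal

variable {E : Type*} [NormedAddCommGroup E] [NormedSpace ℝ E]

/-- Near a critical point, the oscillation of a function on a small ball is small compared with
the radius. -/
theorem HasFDerivAt.eventually_forall_closedBall_abs_sub_le {v : E → ℝ} {x : E}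
    (hv : HasFDerivAt v (0 : E →L[ℝ] ℝ) x) {ε : ℝ} (hε : 0 < ε) :
    ∃ ρ > 0, ∀ r < ρ, ∀ y ∈ closedBall x r, |v y - v x| ≤ ε * r := by
  have h := hv.isLittleO.bound hε
  obtain ⟨ρ, hρ, h⟩ := Metric.eventually_nhds_iff.1 h
  refine ⟨ρ, hρ, fun r hr y hy => ?_⟩
  have hy' : dist y x ≤ r := hy
  have := h (hy'.trans_lt hr)
  simp only [zero_apply, sub_zero, Real.norm_eq_abs] at this
  rw [← dist_eq_norm] at this
  exact this.trans (by gcongr)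

variable [FiniteDimensional ℝ E] [MeasurableSpace E] [BorelSpace E]

/-- A set of critical points is covered by countably many small balls of controlled total measure
on which the function has small oscillation compared with the radius. -/
theorem exists_closedBall_covering_critical (μ : Measure E) [μ.IsAddHaarMeasure] {v : E → ℝ}
    {s : Set E} (hv : ∀ x ∈ s, HasFDerivAt v (0 : E →L[ℝ] ℝ) x) {ε : ℝ} (hε : 0 < ε) :
    ∃ (t : Set E) (r : E → ℝ), t.Countable ∧
      (∀ x ∈ t, 0 < r x ∧ r x < ε ∧ ∀ y ∈ closedBall x (r x), |v y - v x| ≤ ε * r x) ∧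
      s ⊆ ⋃ x ∈ t, closedBall x (r x) ∧
      ∑' x : t, μ (closedBall (x : E) (r x)) ≤ μ s + 1 := by
  obtain ⟨t, r, htc, -, hr, hcov, hsum⟩ :=
    Besicovitch.exists_closedBall_covering_tsum_measure_le μ one_ne_zero
      (fun x => {r | 0 < r ∧ r < ε ∧ ∀ y ∈ closedBall x r, |v y - v x| ≤ ε * r}) s (by
        intro x hx δ hδ
        obtain ⟨ρ, hρ, h⟩ := (hv x hx).eventually_forall_closedBall_abs_sub_le hε
        obtain ⟨r, hr0, hr⟩ := exists_between (lt_min (lt_min hδ hε) hρ)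
        simp only [lt_min_iff] at hr
        exact ⟨r, ⟨hr0, hr.1.2, h r hr.2⟩, hr0, hr.1.1⟩)
  exact ⟨t, r, htc, hr, hcov, hsum⟩

theorem ediam_closedBall_le_ofReal {X : Type*} [PseudoMetricSpace X] (x : X) (r : ℝ) :
    ediam (closedBall x r) ≤ ENNReal.ofReal (2 * r) := by
  refine ediam_le fun y hy z hz => ?_
  rw [edist_dist]
  refine ENNReal.ofReal_le_ofReal ((dist_triangle_right y z x).trans ?_)
  rw [mem_closedBall] at hy hz
  linarith

/-- Almost every level set meets a set of critical points of finite measure in a null set for the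
codimension one Hausdorff measure. -/
theorem ae_hausdorffMeasure_inter_level_eq_zero (μ : Measure E) [μ.IsAddHaarMeasure] {m : ℕ}
    (hm : finrank ℝ E = m + 1) {v : E → ℝ} {s : Set E} (hs : μ s ≠ ∞)
    (hv : ∀ x ∈ s, HasFDerivAt v (0 : E →L[ℝ] ℝ) x) :
    ∀ᵐ a : ℝ, μH[(m : ℝ)] (s ∩ v ⁻¹' {a}) = 0 := by
  have hpos : ∀ k : ℕ, (0 : ℝ) < 1 / ((k : ℝ) + 1) := fun k => Nat.one_div_pos_of_nat
  set ε : ℕ → ℝ := fun k => 1 / ((k : ℝ) + 1) with hε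
  have hε0 : Tendsto ε atTop (𝓝 0) := tendsto_one_div_add_atTop_nhds_zero_nat
  choose t r htc hr hcov hsum using fun k => exists_closedBall_covering_critical μ hv (hpos k)
  have : ∀ k, Countable (t k) := fun k => (htc k).to_subtype
  let I : ∀ k, t k → Set ℝ := fun k x => closedBall (v x) (ε k * r k x)
  let c : ∀ k, t k → ℝ≥0∞ := fun k x => ENNReal.ofReal (2 * r k x) ^ m
  let g : ℕ → ℝ → ℝ≥0∞ := fun k a => ∑' x : t k, (I k x).indicator (fun _ => c k x) a
  have hmeas : ∀ k (x : t k), Measurable ((I k x).indicator (fun _ => c k x)) :=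
    fun k x => measurable_const.indicator isClosed_closedBall.measurableSet
  have hgm : ∀ k, Measurable (g k) := fun k => Measurable.tsum fun x => hmeas k x
  have hB0 : μ (ball (0 : E) 1) ≠ 0 := (measure_ball_pos μ 0 one_pos).ne'
  have hBtop : μ (ball (0 : E) 1) ≠ ∞ := measure_ball_lt_top.ne
  have hterm : ∀ k (x : t k), c k x * volume (I k x) =
      ENNReal.ofReal (2 ^ (m + 1) * ε k) * (μ (ball (0 : E) 1))⁻¹ *
        μ (closedBall (x : E) (r k x)) := by
    intro k x
    have hr0 := (hr k x x.2).1
    rw [Measure.addHaar_closedBall μ _ hr0.le, hm, mul_comm (ENNReal.ofReal (r k x ^ (m + 1))),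
      mul_assoc, ← mul_assoc (μ (ball (0 : E) 1))⁻¹, ENNReal.inv_mul_cancel hB0 hBtop, one_mul,
      Real.volume_closedBall, show c k x = ENNReal.ofReal (2 * r k x) ^ m from rfl,
      ← ENNReal.ofReal_pow (by positivity),
      ← ENNReal.ofReal_mul (by positivity),
      ← ENNReal.ofReal_mul (mul_nonneg (by positivity) (hpos k).le)]
    congr 1
    ring
  have hint : ∀ k, ∫⁻ a, g k a ≤
      ENNReal.ofReal (2 ^ (m + 1) * ε k) * ((μ (ball (0 : E) 1))⁻¹ * (μ s + 1)) := by
    intro k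
    calc ∫⁻ a, g k a = ∑' x : t k, c k x * volume (I k x) := by
          rw [lintegral_tsum fun x => (hmeas k x).aemeasurable]
          exact tsum_congr fun x =>
            lintegral_indicator_const isClosed_closedBall.measurableSet _
      _ = ENNReal.ofReal (2 ^ (m + 1) * ε k) * (μ (ball (0 : E) 1))⁻¹ *
            ∑' x : t k, μ (closedBall (x : E) (r k x)) := by
          rw [← ENNReal.tsum_mul_left]
          exact tsum_congr (hterm k)
      _ ≤ _ := by
          rw [← mul_assoc]
          gcongr
          exact hsum k
  have hlim : Tendsto (fun k => ∫⁻ a, g k a) atTop (𝓝 0) := by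
    refine tendsto_of_tendsto_of_tendsto_of_le_of_le tendsto_const_nhds ?_
      (fun _ => zero_le) hint
    have h1 : Tendsto (fun k => ENNReal.ofReal (2 ^ (m + 1) * ε k)) atTop (𝓝 0) := by
      have := ENNReal.tendsto_ofReal (hε0.const_mul (2 ^ (m + 1)))
      rwa [mul_zero, ENNReal.ofReal_zero] at this
    simpa using ENNReal.Tendsto.mul_const h1
      (Or.inr (ENNReal.mul_ne_top (ENNReal.inv_ne_top.2 hB0) (by simp [hs])))
  have hae : ∀ᵐ a : ℝ, liminf (fun k => g k a) atTop = 0 := by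
    refine (lintegral_eq_zero_iff (Measurable.liminf hgm)).1 (le_antisymm ?_ zero_le)
    exact (lintegral_liminf_le hgm).trans hlim.liminf_eq.le
  filter_upwards [hae] with a ha
  refine le_antisymm ?_ zero_le
  rw [← ha]
  refine (Measure.hausdorffMeasure_le_liminf_tsum (ι := fun k => {x : t k | a ∈ I k x}) (m : ℝ) _
    (l := atTop) (fun k => ENNReal.ofReal (2 * ε k)) ?_
    (fun k x => closedBall (x : E) (r k x)) (Eventually.of_forall fun k x => ?_)
    (Eventually.of_forall fun k => ?_)).trans
    (liminf_le_liminf (Eventually.of_forall fun k => ?_))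
  · simpa using ENNReal.tendsto_ofReal (hε0.const_mul 2)
  · refine (ediam_closedBall_le_ofReal _ _).trans (ENNReal.ofReal_le_ofReal ?_)
    have := (hr k x x.1.2).2.1
    simp only [hε]
    linarith
  · rintro y ⟨hys, hya⟩
    obtain ⟨x, hx, hxy⟩ := mem_iUnion₂.1 (hcov k hys)
    refine mem_iUnion.2 ⟨⟨⟨x, hx⟩, ?_⟩, hxy⟩
    have := (hr k x hx).2.2 y hxy
    rw [mem_preimage, mem_singleton_iff] at hya
    rwa [hya] at this
  · calc ∑' x : {x : t k | a ∈ I k x}, ediam (closedBall (x : E) (r k x)) ^ (m : ℝ)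
        ≤ ∑' x : {x : t k | a ∈ I k x}, c k x := by
          refine ENNReal.tsum_le_tsum fun x => ?_
          rw [ENNReal.rpow_natCast]
          exact pow_le_pow_left' (ediam_closedBall_le_ofReal _ _) m
      _ = g k a := by
          rw [tsum_subtype {x : t k | a ∈ I k x} (c k)]
          rfl

end CriticalLevelSets

/-- If `v : ℝⁿ → ℝ` is Lipschitz, then for Lebesgue-almost every `t ∈ ℝ`, the
`(n−1)`-dimensional Hausdorff measure of
`{y : v(y) = t, v differentiable at y, ∇v(y) = 0}` is zero. -/
theorem ae_hausdorff_measure_critical_level_zero (n : ℕ)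
    (v : EuclideanSpace ℝ (Fin n) → ℝ) (K : NNReal) (hv : LipschitzWith K v) :
    ∀ᵐ t : ℝ ∂(volume : Measure ℝ),
      μH[(n : ℝ) - 1] {y : EuclideanSpace ℝ (Fin n) |
        v y = t ∧ DifferentiableAt ℝ v y ∧ gradient v y = 0} = 0 := by
  rcases n with _ | m
  · filter_upwards [Measure.ae_ne volume (v 0)] with t ht
    refine measure_mono_null (Set.subset_empty_iff.2 ?_) measure_empty
    refine Set.eq_empty_of_forall_notMem fun y hy => ht ?_
    rw [← hy.1, Subsingleton.elim y 0]
  · have h : ∀ R : ℕ, ∀ᵐ t : ℝ, μH[(m : ℝ)]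
        (({y | DifferentiableAt ℝ v y ∧ gradient v y = 0} ∩ Metric.ball 0 R) ∩ v ⁻¹' {t}) = 0 := by
      refine fun R => ae_hausdorffMeasure_inter_level_eq_zero volume (by simp)
        (measure_mono Set.inter_subset_right |>.trans_lt measure_ball_lt_top).ne ?_
      rintro x ⟨⟨hx, hx0⟩, -⟩
      have := hx.hasFDerivAt
      rwa [← toDual_gradient, hx0, map_zero] at this
    filter_upwards [ae_all_iff.2 h] with t ht
    rw [Nat.cast_succ, add_sub_cancel_right]
    refine measure_mono_null ?_ (measure_iUnion_null ht)
    rintro y ⟨hy, hy'⟩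
    obtain ⟨R, hR⟩ := exists_nat_gt ‖y‖
    exact Set.mem_iUnion.2 ⟨R, ⟨hy', by simpa using hR⟩, hy⟩
end

section
/- Let n ≥ 1 and let Ω ⊆ ℝⁿ be an open bounded set. Let u : Ω → ℝ be differentiable on Ω with Lipschitz gradient ∇u (so that the Hessian D²u(x), i.e. the derivative of ∇u, exists for almost every x ∈ Ω by Rademacher's theorem). Let F be a real-valued function on symmetric n×n matrices with F(0) = 0, and let g : ℝ → ℝ satisfy g(t) < 0 for all t with 0 < t ≤ |Ω|. Assume that for almost every x ∈ Ω at which D²u(x) exists, F(D²u(x)) ≤ g(|{y ∈ Ω : u(y) ≥ u(x)}|). Then for every constant a ∈ ℝ, the level set {x ∈ Ω : u(x) = a} has Lebesgue measure zero. -/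
open MeasureTheory

/-- The derivative of a real function vanishes almost everywhere on a measurable set on which the
function is constant. -/
theorem ae_restrict_fderiv_eq_zero_of_eqOn_const {E : Type*} [NormedAddCommGroup E]
    [NormedSpace ℝ E] [FiniteDimensional ℝ E] [MeasurableSpace E] [BorelSpace E]
    (μ : Measure E) [μ.IsAddHaarMeasure] {f : E → ℝ} {s : Set E} {c : ℝ}
    (hs : MeasurableSet s) (hf : ∀ x ∈ s, f x = c) :
    ∀ᵐ x ∂μ.restrict s, fderiv ℝ f x = 0 := by
  rcases subsingleton_or_nontrivial E with hE | hE
  · exact Filter.Eventually.of_forall fun x => Subsingleton.elim _ _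
  obtain ⟨v, hv⟩ := exists_ne (0 : E)
  have hd : MeasurableSet {x | DifferentiableAt ℝ f x} := measurableSet_of_differentiableAt ℝ f
  have happrox : ApproximatesLinearOn (fun x => f x • v) (0 : E →L[ℝ] E)
      (s ∩ {x | DifferentiableAt ℝ f x}) 0 := by
    intro x hx y hy
    simp [hf x hx.1, hf y hy.1]
  have key := happrox.norm_fderiv_sub_le μ (hs.inter hd)
    (fun x => (fderiv ℝ f x).smulRight v)
    fun x hx => (hx.2.hasFDerivAt.smul_const v).hasFDerivWithinAt
  rw [ae_restrict_iff' (hs.inter hd)] at key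
  rw [ae_restrict_iff' hs]
  filter_upwards [key] with x hx hxs
  by_cases hxd : DifferentiableAt ℝ f x
  · simpa [hv] using hx ⟨hxs, hxd⟩
  · exact fderiv_zero_of_not_differentiableAt hxd

/-- Let `Ω ⊆ ℝⁿ` be open and bounded, `u` differentiable on `Ω` with Lipschitz
gradient (so the Hessian `D²u(x)`, the derivative of `∇u`, exists a.e. in `Ω`). Let `F` be a
real function on matrices with `F(0) = 0` and `g` satisfy `g(t) < 0` for `0 < t ≤ |Ω|`.
If for a.e. `x ∈ Ω` at which the Hessian exists one has
`F(D²u(x)) ≤ g(|{y ∈ Ω : u(y) ≥ u(x)}|)`, then every level set `{x ∈ Ω : u(x) = a}` has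
Lebesgue measure zero. -/
theorem level_sets_null_of_negative_rhs (n : ℕ) (hn : 1 ≤ n)
    (Ω : Set (EuclideanSpace ℝ (Fin n))) (hΩo : IsOpen Ω) (hΩb : Bornology.IsBounded Ω)
    (u : EuclideanSpace ℝ (Fin n) → ℝ)
    (hdiff : ∀ x ∈ Ω, DifferentiableAt ℝ u x)
    (K : NNReal) (hlip : LipschitzOnWith K (fderiv ℝ u) Ω)
    (F : Matrix (Fin n) (Fin n) ℝ → ℝ) (hF0 : F 0 = 0)
    (g : ℝ → ℝ) (hg : ∀ t : ℝ, 0 < t → t ≤ (volume Ω).toReal → g t < 0)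
    (H : EuclideanSpace ℝ (Fin n) → Matrix (Fin n) (Fin n) ℝ)
    (hH : ∀ x i j, H x i j =
      fderiv ℝ (fun z => fderiv ℝ u z (EuclideanSpace.single j 1)) x
        (EuclideanSpace.single i 1))
    (hsub : ∀ᵐ x ∂(volume.restrict Ω), DifferentiableAt ℝ (fderiv ℝ u) x →
      F (H x) ≤ g ((volume {y ∈ Ω | u x ≤ u y}).toReal)) :
    ∀ a : ℝ, volume {x ∈ Ω | u x = a} = 0 := by
  intro a
  by_contra hpos
  set S := {x ∈ Ω | u x = a} with hS
  have hSΩ : S ⊆ Ω := fun x hx => hx.1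
  have hΩm : MeasurableSet Ω := hΩo.measurableSet
  have hSm : MeasurableSet S := by
    have hu : ContinuousOn u Ω := fun x hx => (hdiff x hx).continuousAt.continuousWithinAt
    obtain ⟨t, ht, htS⟩ := continuousOn_iff_isClosed.1 hu {a} isClosed_singleton
    have hSt : S = t ∩ Ω := by
      rw [← htS]
      ext x
      exact and_comm
    rw [hSt]
    exact ht.measurableSet.inter hΩm
  have hgrad : ∀ᵐ x ∂volume.restrict S, fderiv ℝ u x = 0 :=
    ae_restrict_fderiv_eq_zero_of_eqOn_const volume hSm fun x hx => hx.2
  have hTm : MeasurableSet (S ∩ {x | fderiv ℝ u x = 0}) :=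
    hSm.inter (measurable_fderiv ℝ u (measurableSet_singleton 0))
  have hhess : ∀ᵐ x ∂volume, x ∈ S ∩ {x | fderiv ℝ u x = 0} → ∀ j : Fin n,
      fderiv ℝ (fun z => fderiv ℝ u z (EuclideanSpace.single j 1)) x = 0 := by
    rw [← ae_restrict_iff' hTm, ae_all_iff]
    intro j
    refine ae_restrict_fderiv_eq_zero_of_eqOn_const volume (c := 0) hTm fun x hx => ?_
    simp [show fderiv ℝ u x = 0 from hx.2]
  rw [ae_restrict_iff' hSm] at hgrad
  rw [ae_restrict_iff' hΩm] at hsub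
  have hnull : ∀ᵐ x ∂volume, x ∉ S := by
    filter_upwards [hgrad, hhess, hsub,
      hlip.ae_differentiableWithinAt_of_mem (μ := volume)] with x h1 h2 h3 h4 hxS
    have hHx : H x = 0 := by
      ext i j
      simp [hH, h2 ⟨hxS, h1 hxS⟩ j]
    have hle := h3 hxS.1 ((h4 hxS.1).differentiableAt (hΩo.mem_nhds hxS.1))
    rw [hHx, hF0] at hle
    have hsup : {y ∈ Ω | u x ≤ u y} ⊆ Ω := fun y hy => hy.1
    have hsub' : S ⊆ {y ∈ Ω | u x ≤ u y} := fun y hy => ⟨hy.1, by rw [hxS.2, hy.2]⟩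
    have hfin : volume Ω ≠ ⊤ := hΩb.measure_lt_top.ne
    refine (hg _ (ENNReal.toReal_pos ?_ (measure_ne_top_of_subset hsup hfin))
      (ENNReal.toReal_mono hfin (measure_mono hsup))).not_ge hle
    exact fun h => hpos (measure_mono_null hsub' h)
  exact hpos (measure_eq_zero_iff_ae_notMem.2 hnull)
end
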